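/- There do not exist positive integers x, z, w, t satisfying simultaneously x² + z² = w², x² + w² = t², and gcd(x, z) = 1. -/

import Mathlib

/-- The product of two coprime nonnegative integers is a square only if both are. -/
lemma exists_sq_of_coprime_of_nonneg {a b c : ℤ} (hc : IsCoprime a b) (h : a * b = c ^ 2)
    (ha : 0 ≤ a) (hb : 0 ≤ b) : ∃ r s, a = r ^ 2 ∧ b = s ^ 2 := by
  obtain ⟨r, hr⟩ := Int.sq_of_isCoprime hc h
  obtain ⟨s, hs⟩ := Int.sq_of_isCoprime hc.symm ((mul_comm b a).trans h)
  refine ⟨r, s, ?_, ?_⟩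
  · rcases hr with hr | hr
    · exact hr
    · nlinarith [sq_nonneg r]
  · rcases hs with hs | hs
    · exact hs
    · nlinarith [sq_nonneg s]

/-- A primitive solution of `b⁴ + 4a⁴ = w²` gives a smaller solution of the system
`x² + z² = w²`, `x² + w² = t²`. -/
lemma exists_smaller_of_fourth_powers {a b w : ℤ} (ha : a ≠ 0) (hb : b % 2 = 1) (hw : 0 < w)
    (hc : IsCoprime (b ^ 2) (2 * a ^ 2)) (h : (b ^ 2) ^ 2 + (2 * a ^ 2) ^ 2 = w ^ 2) :
    ∃ x z p t : ℤ, x ≠ 0 ∧ IsCoprime x z ∧ 0 < p ∧ p < w ∧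
      x ^ 2 + z ^ 2 = p ^ 2 ∧ x ^ 2 + p ^ 2 = t ^ 2 := by
  have hb2 : b ^ 2 % 2 = 1 := by simp [pow_two, Int.mul_emod, hb]
  have hT : PythagoreanTriple (b ^ 2) (2 * a ^ 2) w := by
    unfold PythagoreanTriple; linarith
  obtain ⟨m, n, hbmn, hamn, hwmn, hgcd, hpar, hm⟩ :=
    hT.coprime_classification' (Int.isCoprime_iff_gcd_eq_one.mp hc) hb2 hw
  have hmn : IsCoprime m n := Int.isCoprime_iff_gcd_eq_one.mpr hgcd
  have ha2 : 0 < a ^ 2 := by positivity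
  have hb0 : 0 < b ^ 2 := by have := sq_nonneg b; lia
  have hprod : m * n = a ^ 2 := by linarith
  have hmpos : 0 < m := by
    rcases hm.eq_or_lt with h0 | h0
    · simp [← h0] at hprod; lia
    · exact h0
  have hnpos : 0 < n := by
    by_contra! hn
    nlinarith
  have hlt : n < m := by nlinarith
  obtain ⟨p, q, rfl, rfl⟩ := exists_sq_of_coprime_of_nonneg hmn hprod hm hnpos.le
  have hodd : (p ^ 2 + q ^ 2) % 2 = 1 := by lia
  have h2 : IsCoprime (p ^ 2 + q ^ 2) 2 :=
    (Int.prime_two.irreducible.coprime_iff_not_dvd.mpr (by lia)).symm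
  have hp : IsCoprime (p ^ 2 + q ^ 2) (p ^ 2) := by
    simpa [add_comm] using (IsCoprime.add_mul_left_left hmn.symm 1)
  have hco : IsCoprime (p ^ 2 + q ^ 2) (p ^ 2 - q ^ 2) := by
    have := IsCoprime.add_mul_left_right (h2.mul_right hp) (-1)
    rwa [show 2 * p ^ 2 + (p ^ 2 + q ^ 2) * -1 = p ^ 2 - q ^ 2 by ring] at this
  obtain ⟨t, z, ht, hz⟩ := exists_sq_of_coprime_of_nonneg (c := b) hco
    (by rw [hbmn]; ring) (by positivity) (by lia)
  have hp0 : p ≠ 0 := by rintro rfl; simp at hmpos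
  have hpq : IsCoprime (q ^ 2) (z ^ 2) := by
    have := IsCoprime.add_mul_left_right hmn.symm (-1)
    rwa [show p ^ 2 + q ^ 2 * -1 = z ^ 2 by linarith] at this
  refine ⟨q, z, |p|, t, by rintro rfl; simp at hnpos,
    (IsCoprime.pow_iff two_pos two_pos).mp hpq, by positivity, ?_, ?_, ?_⟩
  · have h1 : 0 < |p| := by positivity
    rw [← sq_abs p] at hwmn
    nlinarith [pow_pos hnpos 2, pow_pos h1 2, pow_pos h1 3]
  · rw [sq_abs]; linarith
  · rw [sq_abs]; linarith

/-- If `u`, `v` are coprime legs with `u` even and `uv` twice a nonzero square, then the system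
has a solution smaller than the hypotenuse. -/
lemma exists_smaller_of_even_leg {u v w y : ℤ} (hw : 0 < w) (hy : y ≠ 0)
    (huv : IsCoprime u v) (hu : u % 2 = 0) (hmul : u * v = 2 * y ^ 2)
    (h : u ^ 2 + v ^ 2 = w ^ 2) :
    ∃ x z p t : ℤ, x ≠ 0 ∧ IsCoprime x z ∧ 0 < p ∧ p < w ∧
      x ^ 2 + z ^ 2 = p ^ 2 ∧ x ^ 2 + p ^ 2 = t ^ 2 := by
  obtain ⟨c, rfl⟩ : (2 : ℤ) ∣ u := Int.dvd_of_emod_eq_zero hu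
  have hcv : c * v = y ^ 2 := by linarith
  have hcop : IsCoprime c v := huv.of_mul_left_right
  have hv : ¬ (2 : ℤ) ∣ v :=
    Int.prime_two.irreducible.coprime_iff_not_dvd.mp huv.of_mul_left_left
  obtain ⟨a, ha⟩ := Int.sq_of_isCoprime hcop hcv
  obtain ⟨b, hb⟩ := Int.sq_of_isCoprime hcop.symm ((mul_comm v c).trans hcv)
  have ha0 : a ≠ 0 := by
    rintro rfl
    have : c = 0 := by simpa using ha
    exact hy (pow_eq_zero_iff two_ne_zero |>.mp (by rw [← hcv, this, zero_mul]))
  have hb1 : b % 2 = 1 := by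
    by_contra hb2
    have : (2 : ℤ) ∣ b ^ 2 := dvd_pow (by lia) two_ne_zero
    exact hv (by rcases hb with rfl | rfl <;> simpa using this)
  refine exists_smaller_of_fourth_powers ha0 hb1 hw ?_ ?_
  · rcases ha with rfl | rfl <;> rcases hb with rfl | rfl <;>
      simpa [IsCoprime.neg_left_iff, IsCoprime.neg_right_iff] using huv.symm
  · rcases ha with rfl | rfl <;> rcases hb with rfl | rfl <;> linarith

/-- The descent step. -/
lemma exists_smaller_solution {x z w t : ℤ} (hx : x ≠ 0) (hc : IsCoprime x z) (hw : 0 < w)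
    (h₁ : x ^ 2 + z ^ 2 = w ^ 2) (h₂ : x ^ 2 + w ^ 2 = t ^ 2) :
    ∃ x' z' w' t' : ℤ, x' ≠ 0 ∧ IsCoprime x' z' ∧ 0 < w' ∧ w' < w ∧
      x' ^ 2 + z' ^ 2 = w' ^ 2 ∧ x' ^ 2 + w' ^ 2 = t' ^ 2 := by
  have sq_mod (k : ℤ) : k % 2 = 0 ∧ k ^ 2 % 4 = 0 ∨ k % 2 = 1 ∧ k ^ 2 % 4 = 1 := by
    rcases Int.emod_two_eq_zero_or_one k with hk | hk
    · exact .inl ⟨hk, by obtain ⟨j, rfl⟩ := Int.dvd_of_emod_eq_zero hk; ring_nf; lia⟩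
    · exact .inr ⟨hk, Int.sq_mod_four_eq_one_of_odd (Int.odd_iff.mpr hk)⟩
  have hxz : ¬ (x % 2 = 0 ∧ z % 2 = 0) := fun ⟨hx2, hz2⟩ =>
    Int.prime_two.not_isUnit (hc.isUnit_of_dvd' (Int.dvd_of_emod_eq_zero hx2)
      (Int.dvd_of_emod_eq_zero hz2))
  have hpar : x % 2 = 0 ∧ z % 2 = 1 ∧ t % 2 = 1 := by
    have := sq_mod x; have := sq_mod z; have := sq_mod w; have := sq_mod t
    lia
  obtain ⟨hx2, hz2, ht2⟩ := hpar
  obtain ⟨y, rfl⟩ : (2 : ℤ) ∣ x := Int.dvd_of_emod_eq_zero hx2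
  obtain ⟨v, hv⟩ : (2 : ℤ) ∣ t - z := by lia
  obtain rfl : t = z + 2 * v := by lia
  have hmul : (z + v) * v = 2 * y ^ 2 := by linarith
  have hsum : (z + v) ^ 2 + v ^ 2 = w ^ 2 := by linarith
  have hcop : IsCoprime (z + v) v := by
    have h : IsCoprime z (2 * ((z + v) * v)) := by
      rw [hmul]
      convert hc.symm.pow_right (n := 2) using 1
      ring
    simpa using h.of_mul_right_right.of_mul_right_right.add_mul_left_left 1
  have hy : y ≠ 0 := by rintro rfl; simp at hx
  rcases Int.emod_two_eq_zero_or_one v with hv2 | hv2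
  · exact exists_smaller_of_even_leg hw hy hcop.symm hv2 (by linarith) (by linarith)
  · exact exists_smaller_of_even_leg hw hy hcop (by lia) hmul hsum

/-- The system has no primitive integer solution with `x ≠ 0`, by descent on `w`. -/
lemma no_integer_solution (n : ℕ) : ∀ x z w t : ℤ, w.toNat = n → x ≠ 0 → IsCoprime x z → 0 < w →
    x ^ 2 + z ^ 2 = w ^ 2 → x ^ 2 + w ^ 2 ≠ t ^ 2 := by
  induction n using Nat.strong_induction_on with
  | _ n ih =>
    intro x z w t hn hx hc hw h₁ h₂
    obtain ⟨x', z', w', t', hx', hc', hw', hlt, h₁', h₂'⟩ :=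
      exists_smaller_solution hx hc hw h₁ h₂
    exact ih w'.toNat (by lia) x' z' w' t' rfl hx' hc' hw' h₁' h₂'

/-- Equations (11): the system `x² + z² = w²`, `x² + w² = t²`, `gcd(x, z) = 1`
has no solution in positive integers. -/
theorem no_solution_system_eleven :
    ¬ ∃ x z w t : ℕ, 0 < x ∧ 0 < z ∧ 0 < w ∧ 0 < t ∧
      x ^ 2 + z ^ 2 = w ^ 2 ∧ x ^ 2 + w ^ 2 = t ^ 2 ∧ Nat.gcd x z = 1 := by
  rintro ⟨x, z, w, t, hx, -, hw, -, h₁, h₂, hc⟩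
  exact no_integer_solution _ x z w t rfl (by lia) (Nat.isCoprime_iff_coprime.mpr hc)
    (by lia) (by exact_mod_cast h₁) (by exact_mod_cast h₂)
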